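/- Let q = r^2 where r is an odd prime power, and write q − 1 = e·f for positive integers e, f. Let s be a positive integer with s ∣ f and s ∣ r+1, and set D = s(r−1)/gcd(s(r−1), f). Let t be an integer with 1 ≤ t ≤ D such that t·f is odd. Then there exists an MDS self-dual code over F_q of length t·f + 1. -/

import Mathlib

open Finset

/-- The Euclidean dual of a linear code `C ⊆ F^n`. -/
def euclideanDual {F : Type*} [Field F] {n : ℕ} (C : Submodule F (Fin n → F)) :
    Submodule F (Fin n → F) where
  carrier := {x | ∀ c ∈ C, ∑ i, x i * c i = 0}
  add_mem' := by
    intro a b ha hb c hc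
    have h : ∑ i, (a + b) i * c i = (∑ i, a i * c i) + ∑ i, b i * c i := by
      rw [← Finset.sum_add_distrib]
      exact Finset.sum_congr rfl fun i _ => by simp [add_mul]
    simp only [Set.mem_setOf_eq] at *
    rw [h, ha c hc, hb c hc, add_zero]
  zero_mem' := by
    intro c hc
    simp
  smul_mem' := by
    intro r a ha c hc
    have h : ∑ i, (r • a) i * c i = r * ∑ i, a i * c i := by
      rw [Finset.mul_sum]
      exact Finset.sum_congr rfl fun i _ => by simp [mul_assoc]
    simp only [Set.mem_setOf_eq] at *
    rw [h, ha c hc, mul_zero]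

/-- Hamming weight of a word. -/
noncomputable def hWeight {F : Type*} [Field F] {n : ℕ} (c : Fin n → F) : ℕ := Nat.card {i : Fin n // c i ≠ 0}

/-- `C` is an MDS (Euclidean) self-dual code: it equals its Euclidean dual and its
minimum Hamming distance is `n/2 + 1`. -/
def IsMDSSelfDual {F : Type*} [Field F] {n : ℕ} (C : Submodule F (Fin n → F)) : Prop :=
  C = euclideanDual C ∧
  (∀ c ∈ C, c ≠ 0 → n / 2 + 1 ≤ hWeight c) ∧
  (∃ c ∈ C, c ≠ 0 ∧ hWeight c = n / 2 + 1)

open Classical in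
/-- The quadratic character `η` of a field: `1` on nonzero squares, `-1` on nonsquares,
`0` at `0`. -/
noncomputable def quadChar (F : Type*) [Field F] (x : F) : ℤ :=
  if x = 0 then 0 else if IsSquare x then 1 else -1

open Polynomial Lagrange

theorem finrank_euclideanDual {F : Type*} [Field F] {n : ℕ} (C : Submodule F (Fin n → F)) :
    Module.finrank F (euclideanDual C) = n - Module.finrank F C := by
  let B : LinearMap.BilinForm F (Fin n → F) := dotProductBilin F F
  have hB : B.Nondegenerate := by
    refine ⟨fun x hx => ?_, fun x hx => ?_⟩
    · exact dotProduct_eq_zero x hx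
    · exact dotProduct_eq_zero x fun w => (dotProduct_comm x w).trans (hx w)
  have h : euclideanDual C = B.orthogonal C := by
    ext x
    refine forall₂_congr fun c _ => ?_
    exact iff_of_eq (congrArg (· = 0) (dotProduct_comm x c))
  rw [h, LinearMap.BilinForm.finrank_orthogonal hB, Module.finrank_fin_fun]

/-- The encoder of the extended generalized Reed–Solomon code with evaluation points `a`, column
multipliers `v`, whose additional coordinate is the coefficient of degree `k`. -/
noncomputable def extendedGRSEncoder {F : Type*} [Field F] {n : ℕ} (a v : Fin n → F) (k : ℕ) :
    F[X] →ₗ[F] (Fin (n + 1) → F) where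
  toFun g := Fin.cons (g.coeff k) fun i => v i * g.eval (a i)
  map_add' g h := by
    ext i
    refine Fin.cases ?_ (fun i => ?_) i <;> simp [mul_add]
  map_smul' c g := by
    ext i
    refine Fin.cases ?_ (fun i => ?_) i <;> simp [mul_left_comm]

section ExtendedGRS

variable {F : Type*} [Field F] {n k : ℕ} {a v : Fin n → F}

@[simp]
theorem extendedGRSEncoder_zero_coord (g : F[X]) : extendedGRSEncoder a v k g 0 = g.coeff k := rfl

@[simp]
theorem extendedGRSEncoder_succ_coord (g : F[X]) (i : Fin n) :
    extendedGRSEncoder a v k g i.succ = v i * g.eval (a i) := rfl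

open Classical in
theorem hWeight_add_card_zeros (c : Fin n → F) : hWeight c + #{i | c i = 0} = n := by
  have h := card_filter_add_card_filter_not (s := univ) fun i : Fin n => c i = 0
  rw [card_univ, Fintype.card_fin] at h
  rw [hWeight, Nat.card_eq_fintype_card, Fintype.card_subtype]
  lia

open Classical in
theorem card_zeros_extendedGRSEncoder_le (ha : Function.Injective a) (hv : ∀ i, v i ≠ 0)
    {g : F[X]} (hg : g ≠ 0) (hdeg : g.natDegree ≤ k) :
    #{i | extendedGRSEncoder a v k g i = 0} ≤ k := by
  have hroots : #{i | g.eval (a i) = 0} ≤ g.natDegree := by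
    rw [← card_image_of_injective _ ha]
    refine card_le_degree_of_subset_roots fun x hx => ?_
    obtain ⟨i, hi, rfl⟩ := mem_image.1 (Finset.mem_def.2 hx)
    exact (mem_roots hg).2 (by simpa using hi)
  rw [Fin.card_filter_univ_succ]
  simp only [extendedGRSEncoder_zero_coord, extendedGRSEncoder_succ_coord, mul_eq_zero,
    hv, false_or]
  split_ifs with h
  · have : g.natDegree ≠ k := by
      rintro rfl
      exact hg (leadingCoeff_eq_zero.1 h)
    lia
  · exact hroots.trans hdeg

theorem le_hWeight_extendedGRSEncoder (ha : Function.Injective a) (hv : ∀ i, v i ≠ 0)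
    {g : F[X]} (hg : g ≠ 0) (hdeg : g.natDegree ≤ k) :
    n + 1 ≤ hWeight (extendedGRSEncoder a v k g) + k := by
  classical
  have h₁ := hWeight_add_card_zeros (extendedGRSEncoder a v k g)
  have h₂ := card_zeros_extendedGRSEncoder_le ha hv hg hdeg
  lia

theorem exists_hWeight_extendedGRSEncoder_le (hk : k ≤ n) :
    ∃ g : F[X], g ≠ 0 ∧ g.natDegree = k ∧ hWeight (extendedGRSEncoder a v k g) + k ≤ n + 1 := by
  classical
  obtain ⟨S, -, hS⟩ := exists_subset_card_eq (s := (univ : Finset (Fin n))) (n := k) (by simpa)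
  refine ⟨nodal S a, nodal_ne_zero, by rw [natDegree_nodal, hS], ?_⟩
  have h₁ := hWeight_add_card_zeros (extendedGRSEncoder a v k (nodal S a))
  have h₂ : k ≤ #{i | extendedGRSEncoder a v k (nodal S a) i = 0} := by
    rw [← hS, ← card_map (Fin.succEmb n)]
    refine card_le_card fun x hx => ?_
    obtain ⟨i, hi, rfl⟩ := mem_map.1 hx
    simp [eval_nodal_at_node hi]
  lia

theorem sum_extendedGRSEncoder_mul (hn : n = 2 * k + 1) (ha : Function.Injective a)
    (hv : ∀ i, v i * v i = -nodalWeight univ a i) {g h : F[X]} (hg : g.natDegree ≤ k)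
    (hh : h.natDegree ≤ k) :
    ∑ i, extendedGRSEncoder a v k g i * extendedGRSEncoder a v k h i = 0 := by
  have hdeg : (g * h).degree < #(univ : Finset (Fin n)) := by
    rw [card_univ, Fintype.card_fin]
    refine degree_le_natDegree.trans_lt (Nat.cast_lt.2 ?_)
    have := natDegree_mul_le (p := g) (q := h)
    lia
  have hcoeff := coeff_eq_sum ha.injOn hdeg
  rw [card_univ, Fintype.card_fin, show n - 1 = k + k by lia, coeff_mul_add_eq_of_natDegree_le hg hh]
    at hcoeff
  rw [Fin.sum_univ_succ]
  simp only [extendedGRSEncoder_zero_coord, extendedGRSEncoder_succ_coord]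
  rw [hcoeff, ← sum_add_distrib]
  refine sum_eq_zero fun i _ => ?_
  have hi := hv i
  rw [nodalWeight, prod_inv_distrib] at hi
  rw [mul_mul_mul_comm, hi, eval_mul]
  ring

theorem exists_isMDSSelfDual_of_isSquare_neg_nodalWeight (hn : Odd n)
    (ha : Function.Injective a) (hsq : ∀ i, IsSquare (-nodalWeight univ a i)) :
    ∃ C : Submodule F (Fin (n + 1) → F), IsMDSSelfDual C := by
  obtain ⟨k, hk⟩ := hn
  choose v hv using hsq
  have hv0 : ∀ i, v i ≠ 0 := fun i h => by
    have := nodalWeight_ne_zero (s := univ) ha.injOn (mem_univ i)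
    have hi := hv i
    rw [h, mul_zero, neg_eq_zero] at hi
    exact this hi
  have hmem : ∀ {g : F[X]}, g ∈ degreeLT F (k + 1) ↔ g.natDegree ≤ k := fun {g} => by
    rw [mem_degreeLT, degree_lt_iff_coeff_zero, natDegree_le_iff_coeff_eq_zero]
    rfl
  let E := extendedGRSEncoder a v k
  have hker : Function.Injective (E.domRestrict (degreeLT F (k + 1))) := by
    rw [← LinearMap.ker_eq_bot, LinearMap.ker_eq_bot']
    rintro ⟨g, hg⟩ h
    by_contra hne
    have hw := le_hWeight_extendedGRSEncoder ha hv0 (fun h0 => hne (Subtype.ext h0)) (hmem.1 hg)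
    have h0 : hWeight (extendedGRSEncoder a v k g) = 0 := by
      rw [show extendedGRSEncoder a v k g = 0 from h]
      simp [hWeight]
    lia
  have hfin : Module.finrank F ((degreeLT F (k + 1)).map E) = k + 1 := by
    rw [← LinearMap.range_domRestrict, LinearMap.finrank_range_of_inj hker,
      (degreeLTEquiv F (k + 1)).finrank_eq, Module.finrank_fin_fun]
  refine ⟨(degreeLT F (k + 1)).map E, ?_, ?_, ?_⟩
  · refine Submodule.eq_of_le_of_finrank_eq ?_ ?_
    · rintro _ ⟨g, hg, rfl⟩ _ ⟨h, hh, rfl⟩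
      exact sum_extendedGRSEncoder_mul hk ha (fun i => (hv i).symm) (hmem.1 hg) (hmem.1 hh)
    · rw [finrank_euclideanDual, hfin]
      lia
  · rintro _ ⟨g, hg, rfl⟩ hne
    have := le_hWeight_extendedGRSEncoder ha hv0
      (fun h0 => hne (by rw [h0, map_zero])) (hmem.1 hg)
    change _ ≤ hWeight (extendedGRSEncoder a v k g)
    lia
  · obtain ⟨g, hg0, hg, hw⟩ := exists_hWeight_extendedGRSEncoder_le (a := a) (v := v)
      (show k ≤ n by lia)
    have hw' := le_hWeight_extendedGRSEncoder ha hv0 hg0 hg.le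
    have hE : hWeight (E g) = (n + 1) / 2 + 1 := by
      change hWeight (extendedGRSEncoder a v k g) = _
      lia
    refine ⟨E g, ⟨g, hmem.2 hg.le, rfl⟩, fun h0 => ?_, hE⟩
    rw [h0] at hE
    simp [hWeight] at hE

end ExtendedGRS

section Cosets

variable {F : Type*} [Field F] {t f : ℕ}

/-- The points `ζ ^ j * b l`, which for `ζ` a primitive `f`-th root of unity run through the
cosets of the group of `f`-th roots of unity represented by the `b l`. -/
def cosetPoints (ζ : F) (b : Fin t → F) (i : Fin (t * f)) : F :=
  ζ ^ ((finProdFinEquiv.symm i).2 : ℕ) * b (finProdFinEquiv.symm i).1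

variable {ζ : F} {b : Fin t → F}

theorem cosetPoints_pow (hζ : IsPrimitiveRoot ζ f) (i : Fin (t * f)) :
    cosetPoints ζ b i ^ f = b (finProdFinEquiv.symm i).1 ^ f := by
  rw [cosetPoints, mul_pow, pow_right_comm, hζ.pow_eq_one, one_pow, one_mul]

theorem cosetPoints_injective (hζ : IsPrimitiveRoot ζ f) (hb0 : ∀ l, b l ≠ 0)
    (hb : Function.Injective fun l => b l ^ f) :
    Function.Injective (cosetPoints (f := f) ζ b) := by
  intro i j hij
  have h₁ : (finProdFinEquiv.symm i).1 = (finProdFinEquiv.symm j).1 :=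
    hb (by simpa only [cosetPoints_pow hζ] using congrArg (· ^ f) hij)
  refine finProdFinEquiv.symm.injective (Prod.ext h₁ (Fin.ext ?_))
  rw [cosetPoints, cosetPoints, h₁] at hij
  exact hζ.pow_inj (Fin.is_lt _) (Fin.is_lt _) (mul_right_cancel₀ (hb0 _) hij)

theorem nodal_cosetPoints (hf : 0 < f) (hζ : IsPrimitiveRoot ζ f) :
    nodal univ (cosetPoints (f := f) ζ b) = (nodal univ fun l => b l ^ f).comp (X ^ f) := by
  rw [nodal, nodal, Polynomial.prod_comp, ← finProdFinEquiv.prod_comp, Fintype.prod_prod_type]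
  refine prod_congr rfl fun l _ => ?_
  rw [sub_comp, X_comp, C_comp, X_pow_sub_C_eq_prod hζ hf rfl, prod_range]
  simp [cosetPoints]

theorem nodalWeight_cosetPoints (hf : 0 < f) (hζ : IsPrimitiveRoot ζ f) (i : Fin (t * f)) :
    nodalWeight univ (cosetPoints ζ b) i =
      ((f : F) * cosetPoints ζ b i ^ (f - 1))⁻¹ *
        nodalWeight univ (fun l => b l ^ f) (finProdFinEquiv.symm i).1 := by
  rw [nodalWeight_eq_eval_derivative_nodal (mem_univ _),
    nodalWeight_eq_eval_derivative_nodal (mem_univ _), nodal_cosetPoints hf hζ, derivative_comp]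
  simp [cosetPoints_pow hζ, derivative_X_pow, mul_comm]

end Cosets

theorem nodalWeight_mem {F : Type*} [Field F] {ι : Type*} [DecidableEq ι] (K : Subfield F)
    {s : Finset ι} {v : ι → F} (hv : ∀ i ∈ s, v i ∈ K) {i : ι} (hi : i ∈ s) :
    nodalWeight s v i ∈ K :=
  prod_mem fun j hj => inv_mem (sub_mem (hv i hi) (hv j (mem_of_mem_erase hj)))

theorem isSquare_of_pow_eq_self {F : Type*} [Field F] [Fintype F] {r : ℕ} (hr : Odd r)
    (hF : Fintype.card F = r ^ 2) {x : F} (hx : x ^ r = x) : IsSquare x := by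
  obtain rfl | hx0 := eq_or_ne x 0
  · exact IsSquare.zero
  have hchar : ringChar F ≠ 2 := fun h => by
    have := FiniteField.even_card_iff_char_two.1 h
    rw [hF, ← Nat.even_iff] at this
    exact Nat.not_even_iff_odd.2 hr.pow this
  rw [FiniteField.isSquare_iff hchar hx0, hF]
  obtain ⟨m, rfl⟩ := hr
  have hx1 : x ^ (2 * m) = 1 := mul_right_cancel₀ hx0 (by rw [← pow_succ, hx, one_mul])
  rw [show (2 * m + 1) ^ 2 / 2 = 2 * m * (m + 1) by
    rw [show (2 * m + 1) ^ 2 = 2 * (2 * m * (m + 1)) + 1 by ring]; lia, pow_mul, hx1, one_pow]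

theorem stmt_17 (r e f s t p k : ℕ) (hp : p.Prime) (hpodd : Odd p) (hr : r = p ^ k)
    (hk : 0 < k) (he : 0 < e) (hf : 0 < f) (heq : r ^ 2 - 1 = e * f)
    (hs : 0 < s) (hsf : s ∣ f) (hsr : s ∣ r + 1)
    (ht1 : 1 ≤ t) (ht2 : t ≤ s * (r - 1) / Nat.gcd (s * (r - 1)) f)
    (htf : Odd (t * f))
    (F : Type*) [Field F] [Fintype F] (hF : Fintype.card F = r ^ 2) :
    ∃ C : Submodule F (Fin (t * f + 1) → F), IsMDSSelfDual C := by
  have := Fact.mk hp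
  have hrodd : Odd r := hr ▸ hpodd.pow
  have : CharP F p := charP_of_card_eq_prime_pow (f := k * 2) (by rw [hF, hr, pow_mul])
  let K : Subfield F := (iterateFrobenius F p k).eqLocusField (RingHom.id F)
  have hK : ∀ {x : F}, x ∈ K ↔ x ^ r = x := fun {x} => by
    rw [hr, ← iterateFrobenius_def]
    rfl
  have hsq : ∀ {x : F}, x ∈ K → IsSquare x := fun hx =>
    isSquare_of_pow_eq_self hrodd hF (hK.1 hx)
  have hr1 : 1 < r := hr ▸ Nat.one_lt_pow hk.ne' hp.one_lt
  have hfact : r ^ 2 - 1 = (r + 1) * (r - 1) := by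
    simpa using Nat.sq_sub_sq r 1
  obtain ⟨g, hg⟩ := IsCyclic.exists_generator (α := Fˣ)
  have hgord : orderOf g = r ^ 2 - 1 := by
    rw [orderOf_eq_card_of_forall_mem_zpowers hg, Nat.card_units, Nat.card_eq_fintype_card, hF]
  have hgprim : IsPrimitiveRoot (g : F) (r ^ 2 - 1) :=
    IsPrimitiveRoot.coe_units_iff.2 (hgord ▸ IsPrimitiveRoot.orderOf g)
  have hpos : 0 < r ^ 2 - 1 := heq ▸ Nat.mul_pos he hf
  have hζ : IsPrimitiveRoot ((g : F) ^ e) f := hgprim.pow hpos heq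
  obtain ⟨u, hu⟩ := hsr
  have hh : IsPrimitiveRoot ((g : F) ^ u) (s * (r - 1)) :=
    hgprim.pow hpos (by rw [hfact, hu]; ring)
  let b : Fin t → F := fun l => ((g : F) ^ u) ^ (l : ℕ)
  have hβ : ∀ l, b l ^ f = (((g : F) ^ u) ^ f) ^ (l : ℕ) := fun l => pow_right_comm _ _ _
  have hb : Function.Injective fun l => b l ^ f := fun l m hlm => by
    simp only [hβ] at hlm
    have hord : orderOf (((g : F) ^ u) ^ f) = s * (r - 1) / Nat.gcd (s * (r - 1)) f := by
      rw [orderOf_pow' _ hf.ne', ← hh.eq_orderOf]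
    refine Fin.ext (pow_injOn_Iio_orderOf ?_ ?_ hlm) <;>
      exact Set.mem_Iio.2 (hord ▸ (Fin.is_lt _).trans_le ht2)
  have hbK : ∀ l, b l ^ f ∈ K := fun l => by
    rw [hβ]
    refine pow_mem (hK.2 ?_) _
    obtain ⟨c, hc⟩ := hsf
    have h1 : (((g : F) ^ u) ^ f) ^ (r - 1) = 1 := by
      rw [← pow_mul, hc, show s * c * (r - 1) = s * (r - 1) * c by ring, pow_mul, hh.pow_eq_one,
        one_pow]
    nth_rw 1 [← Nat.sub_add_cancel hr1.le]
    rw [pow_succ, h1, one_mul]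
  have hfodd : Odd f := (Nat.odd_mul.1 htf).2
  refine exists_isMDSSelfDual_of_isSquare_neg_nodalWeight htf
    (cosetPoints_injective hζ (fun l => by simp [b]) hb) fun i => ?_
  rw [nodalWeight_cosetPoints hf hζ, neg_mul_eq_mul_neg]
  refine IsSquare.mul (IsSquare.inv (IsSquare.mul (hsq (natCast_mem K f)) ?_)) (hsq (neg_mem ?_))
  · exact (Nat.Odd.sub_odd hfodd odd_one).isSquare_pow _
  · exact nodalWeight_mem K (fun l _ => hbK l) (mem_univ _)
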